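/- Let D be a real number with 0 < D < 2π and let T > 0. There is no differentiable function A : [T,∞) → ℝ such that A(t) > 0 for all t ≥ T and A′(t) ≤ (3/4)·(1/(t + 1/4))·A(t) − 2π + D for all t ≥ T. -/

import Mathlib

/-- If `A' ≤ (3/4) A / (t + 1/4) - c` on `[T, ∞)`, then multiplying by the integrating factor
`(t + 1/4) ^ (-3/4)` yields a quantity that decreases on `[T, ∞)`. -/
theorem antitoneOn_integratingFactor_mul_add {A A' : ℝ → ℝ} {T c : ℝ} (hT : 0 < T)
    (hA : ∀ t, T ≤ t → HasDerivAt A (A' t) t)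
    (hle : ∀ t, T ≤ t → A' t ≤ (3/4) * (1/(t + 1/4)) * A t - c) :
    AntitoneOn (fun t ↦ A t * (t + 1/4) ^ (-(3/4) : ℝ) + 4 * c * (t + 1/4) ^ (1/4 : ℝ))
      (Set.Ici T) := by
  have hderiv : ∀ t, T ≤ t → HasDerivAt
      (fun t ↦ A t * (t + 1/4) ^ (-(3/4) : ℝ) + 4 * c * (t + 1/4) ^ (1/4 : ℝ))
      ((t + 1/4) ^ (-(3/4) : ℝ) * (A' t - (3/4) * (1/(t + 1/4)) * A t + c)) t := by
    intro t ht
    have hpos : 0 < t + 1/4 := by linarith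
    have hshift : HasDerivAt (fun t : ℝ ↦ t + 1/4) 1 t := (hasDerivAt_id t).add_const _
    have hneg := hshift.rpow_const (p := -(3/4)) (Or.inl hpos.ne')
    have hroot := hshift.rpow_const (p := 1/4) (Or.inl hpos.ne')
    refine (((hA t ht).mul hneg).add (hroot.const_mul (4 * c))).congr_deriv ?_
    rw [Real.rpow_sub_one hpos.ne', show (1/4 - 1 : ℝ) = -(3/4) by norm_num]
    ring
  refine antitoneOn_of_hasDerivWithinAt_nonpos (convex_Ici T)
    (fun t ht ↦ (hderiv t ht).continuousAt.continuousWithinAt)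
    (fun t ht ↦ (hderiv t (interior_subset ht)).hasDerivWithinAt) fun t ht ↦ ?_
  have ht : T ≤ t := interior_subset ht
  have hpos : 0 < t + 1/4 := by linarith
  exact mul_nonpos_of_nonneg_of_nonpos (Real.rpow_nonneg hpos.le _) (by linarith [hle t ht])

/-- Let `D` be a real number with `0 < D < 2π` and let `T > 0`. There is no
differentiable function `A : [T,∞) → ℝ` such that `A t > 0` for all `t ≥ T` and
`A' t ≤ (3/4) · (1/(t + 1/4)) · A t − 2π + D` for all `t ≥ T`. -/
theorem no_positive_solution_of_area_inequality
    (D T : ℝ) (hD0 : 0 < D) (hD : D < 2 * Real.pi) (hT : 0 < T) :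
    ¬ ∃ (A A' : ℝ → ℝ),
        (∀ t, T ≤ t → HasDerivAt A (A' t) t) ∧
        (∀ t, T ≤ t → 0 < A t) ∧
        (∀ t, T ≤ t → A' t ≤ (3/4) * (1/(t + 1/4)) * A t - 2 * Real.pi + D) := by
  rintro ⟨A, A', hA, hpos, hle⟩
  have hc : 0 < 4 * (2 * Real.pi - D) := by linarith
  have hanti := antitoneOn_integratingFactor_mul_add (c := 2 * Real.pi - D) hT hA
    fun t ht ↦ by linarith [hle t ht]
  have htop : Filter.Tendsto (fun t : ℝ ↦ 4 * (2 * Real.pi - D) * (t + 1/4) ^ (1/4 : ℝ))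
      Filter.atTop Filter.atTop :=
    ((tendsto_rpow_atTop (by norm_num)).comp
      (Filter.tendsto_atTop_add_const_right _ _ Filter.tendsto_id)).const_mul_atTop hc
  obtain ⟨t, hlarge, ht⟩ := ((htop.eventually_gt_atTop
    (A T * (T + 1/4) ^ (-(3/4) : ℝ) + 4 * (2 * Real.pi - D) * (T + 1/4) ^ (1/4 : ℝ))).and
      (Filter.eventually_ge_atTop T)).exists
  have hbound := hanti Set.self_mem_Ici ht ht
  have hfactor : 0 < A t * (t + 1/4) ^ (-(3/4) : ℝ) :=
    mul_pos (hpos t ht) (Real.rpow_pos_of_pos (by linarith) _)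
  dsimp only at hbound
  linarith
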